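/- Let p and q be primes greater than 3. If there exists k ∈ ZMod p with k ≠ 0 such that the elliptic curve y² = x³ + k over F_p has exactly q points (including the point at infinity), then there exists k' ∈ ZMod q with k' ≠ 0 such that the elliptic curve y² = x³ + k' over F_q has exactly p points (including the point at infinity). -/

import Mathlib

/-- The number of `F_p`-rational points, including the point at infinity, of the elliptic curve
`y² = x³ + k` over `F_p`. -/
noncomputable def Npts (p : ℕ) (k : ZMod p) : ℕ :=
  Nat.card (WeierstrassCurve.Affine.Point
    (WeierstrassCurve.toAffine ⟨0, 0, 0, 0, k⟩))

section QuadraticCharSums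

variable {F : Type*} [Field F] [Fintype F] [DecidableEq F]

/-- The character sum counting the affine points of `y² = x³ + k` up to the main term `#F`. -/
def cubicCharSum (k : F) : ℤ := ∑ x : F, quadraticChar F (x ^ 3 + k)

lemma sum_comp_sq (hF : ringChar F ≠ 2) (f : F → ℤ) :
    ∑ t, f (t ^ 2) = ∑ u, (1 + quadraticChar F u) * f u := by
  rw [← Finset.sum_fiberwise (s := Finset.univ) (g := fun t : F ↦ t ^ 2)]
  refine Finset.sum_congr rfl fun u _ ↦ ?_
  rw [Finset.sum_congr rfl (g := fun _ ↦ f u) fun t ht ↦ by rw [(Finset.mem_filter.mp ht).2],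
    Finset.sum_const, nsmul_eq_mul, add_comm, ← quadraticChar_card_sqrts hF u]
  congr 3
  ext
  simp

lemma sum_quadraticChar_add_mul_add (hF : ringChar F ≠ 2) {a b : F} (hab : a ≠ b) :
    ∑ k, quadraticChar F (k + a) * quadraticChar F (k + b) = -1 := by
  have hd : b - a ≠ 0 := sub_ne_zero.mpr hab.symm
  have hJ : jacobiSum (quadraticChar F) (quadraticChar F) = -quadraticChar F (-1) := by
    have h := jacobiSum_nontrivial_inv (quadraticChar_ne_one hF)
    rwa [(quadraticChar_isQuadratic F).inv] at h
  have hneg : quadraticChar F (-1) * quadraticChar F (-1) = 1 := by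
    rw [← map_mul]; simp
  rw [← ((Equiv.subRight a).bijective.comp (mulLeft_bijective₀ _ (neg_ne_zero.mpr hd))).sum_comp]
  calc _ = ∑ x, quadraticChar F (-1) * (quadraticChar F x * quadraticChar F (1 - x)) := by
        refine Finset.sum_congr rfl fun x _ ↦ ?_
        rw [← map_mul, ← map_mul, ← map_mul, ← one_mul (quadraticChar F (-1 * _)),
          ← quadraticChar_sq_one' hd, ← map_mul]
        congr 1
        simp only [Function.comp_apply, Equiv.subRight_apply]
        ring
    _ = -1 := by
        rw [← Finset.mul_sum, ← jacobiSum, hJ, mul_neg, hneg]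

lemma sum_quadraticChar_add_mul_self (a : F) :
    ∑ k, quadraticChar F (k + a) * quadraticChar F (k + a) = Fintype.card F - 1 := by
  change ∑ k, (fun k ↦ quadraticChar F k * quadraticChar F k) (Equiv.addRight a k) = _
  rw [(Equiv.addRight a).bijective.sum_comp (fun k ↦ quadraticChar F k * quadraticChar F k)]
  have h (k : F) : quadraticChar F k * quadraticChar F k = 1 - if k = 0 then 1 else 0 := by
    split_ifs with hk
    · simp [hk]
    · rw [← sq, quadraticChar_sq_one hk, sub_zero]
  simp [-quadraticChar_apply, h, Finset.sum_sub_distrib]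

lemma sum_quadraticChar_add (hF : ringChar F ≠ 2) (a : F) : ∑ k, quadraticChar F (a + k) = 0 := by
  change ∑ k, quadraticChar F (Equiv.addLeft a k) = 0
  rw [(Equiv.addLeft a).bijective.sum_comp (quadraticChar F), quadraticChar_sum_zero hF]

lemma cubicCharSum_mul_cube (k : F) {d : F} (hd : d ≠ 0) :
    cubicCharSum (k * d ^ 3) = quadraticChar F d * cubicCharSum k := by
  rw [cubicCharSum, ← (mulLeft_bijective₀ d hd).sum_comp, cubicCharSum, Finset.mul_sum]
  refine Finset.sum_congr rfl fun x _ ↦ ?_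
  rw [← map_mul, ← one_mul (quadraticChar F (d * _)), ← quadraticChar_sq_one' hd, ← map_mul]
  congr 1
  ring

lemma sum_cubicCharSum_sq (hF : ringChar F ≠ 2) : ∑ t : F, cubicCharSum (t ^ 2) = 0 := by
  rw [sum_comp_sq hF]
  simp only [add_mul, one_mul, Finset.sum_add_distrib, cubicCharSum, Finset.mul_sum]
  rw [Finset.sum_comm, Finset.sum_comm (f := fun i j : F ↦ quadraticChar F i * _)]
  simp only [sum_quadraticChar_add hF, Finset.sum_const_zero, zero_add]
  have h (x : F) : ∑ u, quadraticChar F u * quadraticChar F (x ^ 3 + u)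
      = -1 + if x = 0 then (Fintype.card F : ℤ) else 0 := by
    split_ifs with hx
    · have := sum_quadraticChar_add_mul_self (0 : F)
      simp only [add_zero] at this
      simp only [hx, ne_eq, OfNat.ofNat_ne_zero, not_false_eq_true, zero_pow, zero_add, this]
      ring
    · have := sum_quadraticChar_add_mul_add hF (pow_ne_zero 3 hx).symm
      simpa only [add_zero, zero_add, add_comm] using this
  simp [-quadraticChar_apply, h, Finset.sum_add_distrib]

lemma exists_cubeRoot_ne_one (h3 : 3 ∣ Fintype.card F - 1) : ∃ w : F, w ≠ 1 ∧ w ^ 3 = 1 := by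
  rw [← Fintype.card_units] at h3
  obtain ⟨w, hw⟩ := exists_prime_orderOf_dvd_card 3 h3
  refine ⟨w, fun h ↦ ?_, ?_⟩
  · rw [Units.val_eq_one.mp h, orderOf_one] at hw
    norm_num at hw
  · have := pow_orderOf_eq_one w
    rw [hw] at this
    rw [← Units.val_pow_eq_pow_val, this, Units.val_one]

lemma card_filter_cube_eq_cube (h3 : 3 ∣ Fintype.card F - 1) {y : F} (hy : y ≠ 0) :
    (Finset.univ.filter fun x : F ↦ x ^ 3 = y ^ 3).card = 3 := by
  obtain ⟨w, hw1, hw3⟩ := exists_cubeRoot_ne_one h3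
  have hw0 : w ≠ 0 := by rintro rfl; simp at hw3
  have hw2 : w ^ 2 + w + 1 = 0 := by
    have : (w - 1) * (w ^ 2 + w + 1) = 0 := by linear_combination hw3
    exact (mul_eq_zero.mp this).resolve_left (sub_ne_zero.mpr hw1)
  have hset : (Finset.univ.filter fun x : F ↦ x ^ 3 = y ^ 3) = {y, w * y, w ^ 2 * y} := by
    ext x
    simp only [Finset.mem_filter, Finset.mem_univ, true_and, Finset.mem_insert,
      Finset.mem_singleton]
    have key : x ^ 3 - y ^ 3 = (x - y) * ((x - w * y) * (x - w ^ 2 * y)) := by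
      linear_combination (x - y) * x * y * hw2 - (x - y) * y ^ 2 * hw3
    rw [← sub_eq_zero, key, mul_eq_zero, mul_eq_zero, sub_eq_zero, sub_eq_zero, sub_eq_zero]
  rw [hset, Finset.card_eq_three]
  refine ⟨y, w * y, w ^ 2 * y, fun h ↦ ?_, fun h ↦ ?_, fun h ↦ ?_, rfl⟩
  · exact hw1 (mul_right_cancel₀ hy (by rw [one_mul]; exact h.symm))
  · have : w ^ 2 = 1 := mul_right_cancel₀ hy (by rw [one_mul]; exact h.symm)
    exact hw1 (by linear_combination hw3 - w * this)
  · have : w = w ^ 2 := mul_right_cancel₀ hy h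
    exact hw1 (mul_left_cancel₀ hw0 (by linear_combination -this))

lemma sum_sq_cubicCharSum (hF : ringChar F ≠ 2) (h3 : 3 ∣ Fintype.card F - 1) :
    ∑ k : F, cubicCharSum k ^ 2 = 2 * Fintype.card F * (Fintype.card F - 1) := by
  have hin (x y : F) : ∑ k, quadraticChar F (x ^ 3 + k) * quadraticChar F (y ^ 3 + k)
      = (Fintype.card F : ℤ) * (if x ^ 3 = y ^ 3 then 1 else 0) - 1 := by
    simp only [add_comm _ (_ : F)]
    split_ifs with h
    · simpa only [h, mul_one, add_comm] using sum_quadraticChar_add_mul_self (y ^ 3)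
    · simpa only [add_comm, mul_zero, sub_zero, zero_sub]
        using sum_quadraticChar_add_mul_add hF h
  have hcount (y : F) : ∑ x : F, (if x ^ 3 = y ^ 3 then (1 : ℤ) else 0)
      = 3 - 2 * if y = 0 then 1 else 0 := by
    rw [Finset.sum_boole]
    split_ifs with hy
    · have : (Finset.univ.filter fun x : F ↦ x ^ 3 = y ^ 3) = {0} := by
        ext x; simp [hy]
      rw [this]; norm_num
    · rw [card_filter_cube_eq_cube h3 hy]; norm_num
  calc ∑ k : F, cubicCharSum k ^ 2
      = ∑ y : F, ∑ x : F, ∑ k, quadraticChar F (x ^ 3 + k) * quadraticChar F (y ^ 3 + k) := by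
        simp only [cubicCharSum, sq, Finset.sum_mul_sum]
        rw [Finset.sum_comm]
        refine (Finset.sum_congr rfl fun x _ ↦ Finset.sum_comm).trans ?_
        exact Finset.sum_comm
    _ = _ := by
        simp only [hin, Finset.sum_sub_distrib, ← Finset.mul_sum, hcount]
        simp
        ring

lemma sum_eq_apply_zero_add_sum_range {m : ℕ} (hm : Fintype.card F = 3 * m + 1) :
    ∃ g : F, g ≠ 0 ∧
      (∀ k : F, k ≠ 0 → ∃ d : F, d ≠ 0 ∧ (k = 1 * d ^ 3 ∨ k = g * d ^ 3 ∨ k = g ^ 2 * d ^ 3)) ∧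
      ∀ f : F → ℤ, (∀ t d, d ≠ 0 → f (t * d ^ 3) = f t) →
        ∑ t, f t = f 0 + m * (f 1 + f g + f (g ^ 2)) := by
  obtain ⟨u, hu⟩ := IsCyclic.exists_generator (α := Fˣ)
  have hcard : Fintype.card Fˣ = 3 * m := by rw [Fintype.card_units, hm, Nat.add_sub_cancel]
  refine ⟨u, u.ne_zero, fun k hk ↦ ?_, fun f hf ↦ ?_⟩
  · have hmem := Finset.mem_univ (Units.mk0 k hk)
    rw [← IsCyclic.image_range_card hu, Finset.mem_image] at hmem
    obtain ⟨i, -, hi⟩ := hmem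
    have hi' : k = (u : F) ^ i := by
      have := congrArg Units.val hi
      simpa using this.symm
    refine ⟨(u : F) ^ (i / 3), pow_ne_zero _ u.ne_zero, ?_⟩
    have hdiv := Nat.div_add_mod i 3
    have hlt := Nat.mod_lt i (show 3 > 0 by norm_num)
    rw [hi']
    generalize i / 3 = n at hdiv ⊢
    interval_cases i % 3 <;> subst hdiv
    · left; ring
    · right; left; ring
    · right; right; ring
  · have hunits : ∑ v : Fˣ, f v = ∑ i ∈ Finset.range (3 * m), f ((u : F) ^ i) := by
      rw [← IsCyclic.image_range_card hu, Finset.sum_image, Nat.card_eq_fintype_card, hcard]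
      · simp
      · intro i hi j hj hij
        rw [← orderOf_eq_card_of_forall_mem_zpowers hu] at hi hj
        exact pow_injOn_Iio_orderOf (by simpa using hi) (by simpa using hj) hij
    have hrange (n : ℕ) : ∑ i ∈ Finset.range (3 * n), f ((u : F) ^ i)
        = n * (f 1 + f u + f ((u : F) ^ 2)) := by
      induction n with
      | zero => simp
      | succ n ih =>
        have hd : (u : F) ^ n ≠ 0 := pow_ne_zero _ u.ne_zero
        rw [show 3 * (n + 1) = 3 * n + 1 + 1 + 1 by ring, Finset.sum_range_succ,
          Finset.sum_range_succ, Finset.sum_range_succ, ih, ← hf 1 _ hd, ← hf u _ hd,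
          ← hf (u ^ 2) _ hd]
        rw [show 1 * ((u : F) ^ n) ^ 3 = (u : F) ^ (3 * n) by ring,
          show (u : F) * ((u : F) ^ n) ^ 3 = (u : F) ^ (3 * n + 1) by ring,
          show (u : F) ^ 2 * ((u : F) ^ n) ^ 3 = (u : F) ^ (3 * n + 1 + 1) by ring]
        push_cast
        ring
    rw [← hrange m, ← hunits, Fintype.sum_eq_add_sum_subtype_ne f 0]
    congr 1
    exact (Equiv.sum_comp unitsEquivNeZero (fun x : {x : F // x ≠ 0} ↦ f x)).symm

/-- The values of `cubicCharSum` at nonzero elements are `± s₀`, `± s₁`, `± s₂`, where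
`s₀ + s₁ + s₂ = 0` and `s₀² + s₁² + s₂² = 6 #F`. -/
lemma exists_cubicCharSum_values (hF : ringChar F ≠ 2) {m : ℕ} (hm : Fintype.card F = 3 * m + 1) :
    ∃ s₀ s₁ s₂ : ℤ, s₀ + s₁ + s₂ = 0 ∧ s₀ ^ 2 + s₁ ^ 2 + s₂ ^ 2 = 6 * Fintype.card F ∧
      ∀ a : ℤ, (∃ k : F, k ≠ 0 ∧ cubicCharSum k = a) ↔
        a ^ 2 = s₀ ^ 2 ∨ a ^ 2 = s₁ ^ 2 ∨ a ^ 2 = s₂ ^ 2 := by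
  have h3 : 3 ∣ Fintype.card F - 1 := ⟨m, by lia⟩
  have hm0 : (m : ℤ) ≠ 0 := by
    have := Fintype.one_lt_card (α := F)
    exact_mod_cast show m ≠ 0 by rintro rfl; lia
  obtain ⟨g, hg, hrep, hsum⟩ := sum_eq_apply_zero_add_sum_range hm
  have hzero : cubicCharSum (0 : F) = 0 := by
    have e (x : F) : quadraticChar F (x ^ 3) = quadraticChar F x := by
      rcases eq_or_ne x 0 with rfl | hx
      · simp
      · rw [pow_succ, map_mul, quadraticChar_sq_one' hx, one_mul]
    simp only [cubicCharSum, add_zero, e, quadraticChar_sum_zero hF]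
  have hg2 := quadraticChar_sq_one hg
  have H1 := sum_cubicCharSum_sq hF
  rw [hsum (fun t ↦ cubicCharSum (t ^ 2)) fun t d hd ↦ by
    rw [show (t * d ^ 3) ^ 2 = t ^ 2 * (d ^ 2) ^ 3 by ring,
      cubicCharSum_mul_cube _ (pow_ne_zero 2 hd), quadraticChar_sq_one' hd, one_mul]] at H1
  have H2 := sum_sq_cubicCharSum hF h3
  rw [hsum (fun t ↦ cubicCharSum t ^ 2) fun t d hd ↦ by
    rw [cubicCharSum_mul_cube _ hd, mul_pow, quadraticChar_sq_one hd, one_mul]] at H2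
  simp only [one_pow, ne_eq, OfNat.ofNat_ne_zero, not_false_eq_true, zero_pow, hzero,
    zero_add] at H1 H2
  rw [show (g ^ 2) ^ 2 = g * g ^ 3 by ring, cubicCharSum_mul_cube _ hg] at H1
  refine ⟨cubicCharSum (1 : F), quadraticChar F g * cubicCharSum g, cubicCharSum (g ^ 2),
    ?_, ?_, fun a ↦ ⟨?_, fun h ↦ ?_⟩⟩
  · linarith [(mul_eq_zero.mp H1).resolve_left hm0]
  · rw [mul_pow, hg2, one_mul]
    refine mul_left_cancel₀ hm0 (H2.trans ?_)
    rw [hm]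
    push_cast
    ring
  · rintro ⟨k, hk, rfl⟩
    rw [mul_pow, hg2, one_mul]
    obtain ⟨d, hd, rfl | rfl | rfl⟩ := hrep k hk <;>
      simp only [cubicCharSum_mul_cube _ hd, mul_pow, quadraticChar_sq_one hd, one_mul (_ : ℤ),
        true_or, or_true]
  · obtain ⟨v, hv⟩ := quadraticChar_exists_neg_one' hF
    have hval {k : F} (hk : k ≠ 0) (hak : a ^ 2 = cubicCharSum k ^ 2) :
        ∃ k : F, k ≠ 0 ∧ cubicCharSum k = a := by
      rcases sq_eq_sq_iff_eq_or_eq_neg.mp hak with rfl | rfl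
      · exact ⟨k, hk, rfl⟩
      · exact ⟨k * v ^ 3, mul_ne_zero hk (pow_ne_zero 3 v.ne_zero), by
          rw [cubicCharSum_mul_cube _ v.ne_zero, hv, neg_one_mul]⟩
    rw [mul_pow, hg2, one_mul] at h
    rcases h with h | h | h
    · exact hval one_ne_zero h
    · exact hval hg h
    · exact hval (pow_ne_zero 2 hg) h

lemma cubicCharSum_eq_zero_of_coprime (hF : ringChar F ≠ 2)
    (h : (Fintype.card F - 1).Coprime 3) (k : F) : cubicCharSum k = 0 := by
  have hinj : Function.Injective fun x : F ↦ x ^ 3 := by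
    intro x y hxy
    simp only at hxy
    rcases eq_or_ne y 0 with rfl | hy
    · simpa using hxy
    rcases eq_or_ne x 0 with rfl | hx
    · exact (by simpa using hxy.symm : y = 0).symm
    have hc : (Nat.card Fˣ).Coprime 3 := by
      rwa [Nat.card_eq_fintype_card, Fintype.card_units]
    have := (powCoprime hc).injective (a₁ := Units.mk0 x hx) (a₂ := Units.mk0 y hy) (by
      ext; simpa using hxy)
    simpa using congrArg Units.val this
  have hbij := Finite.injective_iff_bijective.mp hinj
  rw [cubicCharSum, hbij.sum_comp (fun x ↦ quadraticChar F (x + k)),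
    ← sum_quadraticChar_add hF k]
  simp only [add_comm]

end QuadraticCharSums

lemma Npts_eq_add_cubicCharSum {p : ℕ} [Fact p.Prime] (hp : 3 < p) {k : ZMod p} (hk : k ≠ 0) :
    (Npts p k : ℤ) = p + 1 + cubicCharSum k := by
  have hF : ringChar (ZMod p) ≠ 2 := by rw [ZMod.ringChar_zmod_n]; lia
  have hn (n : ℕ) (h0 : n ≠ 0) (hn : n < p) : (n : ZMod p) ≠ 0 := by
    rw [Ne, ZMod.natCast_eq_zero_iff]
    exact Nat.not_dvd_of_pos_of_lt (Nat.pos_of_ne_zero h0) hn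
  have h2 : (2 : ZMod p) ≠ 0 := by exact_mod_cast hn 2 (by norm_num) (by lia)
  have h3 : (3 : ZMod p) ≠ 0 := by exact_mod_cast hn 3 (by norm_num) hp
  let W : WeierstrassCurve.Affine (ZMod p) := WeierstrassCurve.toAffine ⟨0, 0, 0, 0, k⟩
  have hΔ : W.Δ ≠ 0 := by
    have : W.Δ = -(2 ^ 4 * 3 ^ 3 * k ^ 2) := by
      simp only [W, WeierstrassCurve.Δ, WeierstrassCurve.b₂,
        WeierstrassCurve.b₄, WeierstrassCurve.b₆, WeierstrassCurve.b₈]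
      ring
    rw [this]
    exact neg_ne_zero.mpr (by positivity)
  have hns (x y : ZMod p) : W.Nonsingular x y ↔ y ^ 2 = x ^ 3 + k := by
    rw [← WeierstrassCurve.Affine.equation_iff_nonsingular_of_Δ_ne_zero hΔ,
      WeierstrassCurve.Affine.equation_iff]
    simp [W]
  let e : W.Point ≃ Option (Σ x : ZMod p, {y : ZMod p // y ^ 2 = x ^ 3 + k}) :=
    { toFun := fun P ↦ match P with
        | .zero => none
        | .some x y h => some ⟨x, y, (hns x y).mp h⟩
      invFun := fun P ↦ match P with
        | none => .zero
        | some ⟨x, y, h⟩ => .some x y ((hns x y).mpr h)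
      left_inv := by rintro (_ | _) <;> rfl
      right_inv := by rintro (_ | ⟨_, _, _⟩) <;> rfl }
  have hfib (x : ZMod p) : (Fintype.card {y : ZMod p // y ^ 2 = x ^ 3 + k} : ℤ)
      = quadraticChar (ZMod p) (x ^ 3 + k) + 1 := by
    rw [← quadraticChar_card_sqrts hF, Fintype.card_subtype]
    congr 2
    ext
    simp
  have hcard : Npts p k = Fintype.card (Σ x : ZMod p, {y : ZMod p // y ^ 2 = x ^ 3 + k}) + 1 := by
    rw [Npts, Nat.card_congr e, Nat.card_eq_fintype_card, Fintype.card_option]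
  rw [hcard, Fintype.card_sigma]
  push_cast
  simp only [hfib, Finset.sum_add_distrib, cubicCharSum]
  simp
  ring

/-- A norm equation `4q = a² + 3c²` coming from three integers with zero sum. -/
lemma exists_four_mul_eq_sq_add_three_mul_sq {q a b c : ℤ} (h0 : a + b + c = 0)
    (h : a ^ 2 + b ^ 2 + c ^ 2 = 6 * q) : ∃ d, b - c = 3 * d ∧ 4 * q = a ^ 2 + 3 * d ^ 2 := by
  obtain rfl : a = -b - c := by lia
  have h1 : (3 : ℤ) ∣ (b - c) ^ 2 := ⟨q - b * c, by linarith⟩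
  obtain ⟨d, hd⟩ := Int.prime_three.dvd_of_dvd_pow h1
  refine ⟨d, hd, ?_⟩
  obtain rfl : b = c + 3 * d := by lia
  linarith

/-- Two representations of `4q` by `X² + 3Y²`, with `q` prime, differ by a unit of the Eisenstein
integers, up to conjugation. -/
lemma sq_eq_of_four_mul_prime_eq {q a c A C : ℤ} (hq : Prime q) (hq0 : 0 < q)
    (h : 4 * q = a ^ 2 + 3 * c ^ 2) (H : 4 * q = A ^ 2 + 3 * C ^ 2) :
    A ^ 2 = a ^ 2 ∨ (2 * A) ^ 2 = (a + 3 * c) ^ 2 ∨ (2 * A) ^ 2 = (a - 3 * c) ^ 2 := by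
  wlog hdvd : q ∣ A * c - a * C generalizing C
  · have hprod : q ∣ (A * c - a * C) * (A * c + a * C) :=
      ⟨4 * (c ^ 2 - C ^ 2), by linear_combination (-c ^ 2) * H + C ^ 2 * h⟩
    refine this (C := -C) (by rw [H]; ring) ?_
    have := (hq.dvd_or_dvd hprod).resolve_left hdvd
    rwa [mul_neg, sub_neg_eq_add]
  obtain ⟨m, hm⟩ := hdvd
  have hnorm : (A * a + 3 * C * c) ^ 2 + 3 * (q * m) ^ 2 = 16 * q ^ 2 := by
    rw [← hm]
    linear_combination (-4 * q) * H - (A ^ 2 + 3 * C ^ 2) * h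
  have hn : q ∣ A * a + 3 * C * c := by
    refine hq.dvd_of_dvd_pow (n := 2) ⟨q * (16 - 3 * m ^ 2), ?_⟩
    linarith
  obtain ⟨n, hn⟩ := hn
  have hnm : n ^ 2 + 3 * m ^ 2 = 16 := by
    rw [hn] at hnorm
    refine mul_left_cancel₀ (pow_ne_zero 2 hq0.ne') ?_
    linarith
  have hA : 4 * A = a * n + 3 * c * m := by
    refine mul_left_cancel₀ hq0.ne' ?_
    linear_combination A * h + a * hn + 3 * c * hm
  have hm1 : m ≤ 2 := by nlinarith
  have hm2 : -2 ≤ m := by nlinarith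
  have hn1 : n ≤ 4 := by nlinarith
  have hn2 : -4 ≤ n := by nlinarith
  interval_cases m <;> interval_cases n <;> norm_num at hnm
  · right; left; rw [show 2 * A = -(a + 3 * c) by lia]; ring
  · right; right; rw [show 2 * A = a - 3 * c by lia]
  · left; rw [show A = -a by lia]; ring
  · left; rw [show A = a by lia]
  · right; right; rw [show 2 * A = -(a - 3 * c) by lia]; ring
  · right; left; rw [show 2 * A = a + 3 * c by lia]

/-- For a prime `q ≡ 1 mod 3`, the traces of Frobenius of the curves `y² = x³ + k` over `F_q` are
exactly the integers `a` such that `4q - a²` is three times a square. -/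
lemma exists_Npts_eq_iff {q : ℕ} (hq : q.Prime) (hq3 : 3 < q) (hmod : q % 3 = 1) (a : ℤ) :
    (∃ k : ZMod q, k ≠ 0 ∧ (Npts q k : ℤ) = q + 1 - a) ↔
      ∃ c : ℤ, 4 * (q : ℤ) = a ^ 2 + 3 * c ^ 2 := by
  have : Fact q.Prime := ⟨hq⟩
  have hF : ringChar (ZMod q) ≠ 2 := by rw [ZMod.ringChar_zmod_n]; lia
  obtain ⟨s₀, s₁, s₂, hs, hsq, hval⟩ :=
    exists_cubicCharSum_values hF (m := q / 3) (by rw [ZMod.card]; lia)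
  rw [ZMod.card] at hsq
  have key : (∃ k : ZMod q, k ≠ 0 ∧ (Npts q k : ℤ) = q + 1 - a) ↔
      ∃ k : ZMod q, k ≠ 0 ∧ cubicCharSum k = -a := by
    refine exists_congr fun k ↦ and_congr_right fun hk ↦ ?_
    rw [Npts_eq_add_cubicCharSum hq3 hk]
    lia
  rw [key, hval, neg_sq]
  constructor
  · rintro (h | h | h) <;> rw [h]
    · obtain ⟨d, -, hd⟩ := exists_four_mul_eq_sq_add_three_mul_sq hs hsq
      exact ⟨d, hd⟩
    · obtain ⟨d, -, hd⟩ := exists_four_mul_eq_sq_add_three_mul_sq (q := q) (a := s₁) (b := s₀)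
        (c := s₂) (by lia) (by lia)
      exact ⟨d, hd⟩
    · obtain ⟨d, -, hd⟩ := exists_four_mul_eq_sq_add_three_mul_sq (q := q) (a := s₂) (b := s₀)
        (c := s₁) (by lia) (by lia)
      exact ⟨d, hd⟩
  · rintro ⟨c, hc⟩
    obtain ⟨d, hd, hd'⟩ := exists_four_mul_eq_sq_add_three_mul_sq hs hsq
    rcases sq_eq_of_four_mul_prime_eq (Nat.prime_iff_prime_int.mp hq) (by lia) hd' hc
      with h | h | h
    · exact Or.inl h
    · right; right
      rw [← hd, show s₀ + (s₁ - s₂) = 2 * -s₂ by lia] at h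
      linarith
    · right; left
      rw [← hd, show s₀ - (s₁ - s₂) = 2 * -s₁ by lia] at h
      linarith

lemma Npts_eq_add_one_of_mod_three {p : ℕ} (hp : p.Prime) (hp3 : 3 < p) (hmod : p % 3 ≠ 1)
    {k : ZMod p} (hk : k ≠ 0) : Npts p k = p + 1 := by
  have : Fact p.Prime := ⟨hp⟩
  have hF : ringChar (ZMod p) ≠ 2 := by rw [ZMod.ringChar_zmod_n]; lia
  have hc : (Fintype.card (ZMod p) - 1).Coprime 3 := by
    rw [ZMod.card, Nat.coprime_comm, Nat.prime_three.coprime_iff_not_dvd]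
    lia
  have h := Npts_eq_add_cubicCharSum hp3 hk
  rw [cubicCharSum_eq_zero_of_coprime hF hc] at h
  lia

/-- The Law of Elliptic Reciprocity (Theorem 2.7, case `d = 3`, `j = 0`): if some curve
`y² = x³ + k` over `F_p` has exactly `q` points, then some curve `y² = x³ + k'` over `F_q` has
exactly `p` points. -/
theorem stmt_5 (p q : ℕ) (hp : p.Prime) (hq : q.Prime) (hp3 : 3 < p) (hq3 : 3 < q)
    (h : ∃ k : ZMod p, k ≠ 0 ∧ Npts p k = q) :
    ∃ k' : ZMod q, k' ≠ 0 ∧ Npts q k' = p := by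
  obtain ⟨k, hk, hkq⟩ := h
  by_cases hmod : p % 3 = 1
  · obtain ⟨c, hc⟩ := (exists_Npts_eq_iff hp hp3 hmod (p + 1 - q)).mp ⟨k, hk, by rw [hkq]; ring⟩
    have hc' : 4 * (q : ℤ) = (q + 1 - p) ^ 2 + 3 * c ^ 2 := by linear_combination hc
    have hqmod : q % 3 = 1 := by
      have hq0 : ¬ 3 ∣ q := fun h ↦ by
        have := (Nat.prime_dvd_prime_iff_eq Nat.prime_three hq).mp h
        lia
      have hsq : ((q + 1 - p : ℤ) ^ 2) % 3 = q % 3 := by lia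
      rcases (by lia : (q + 1 - p : ℤ) % 3 = 0 ∨ (q + 1 - p : ℤ) % 3 = 1 ∨
        (q + 1 - p : ℤ) % 3 = 2) with h | h | h <;> rw [pow_two, Int.mul_emod, h] at hsq <;> lia
    obtain ⟨k', hk', hN⟩ := (exists_Npts_eq_iff hq hq3 hqmod (q + 1 - p)).mpr ⟨c, hc'⟩
    exact ⟨k', hk', by lia⟩
  · rw [Npts_eq_add_one_of_mod_three hp hp3 hmod hk] at hkq
    have hp2 := hp.eq_two_or_odd
    have hq2 := hq.eq_two_or_odd
    lia
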